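/- arXiv:2011.11623 — 3 statements merged into one kernel-verified Lean document; each statement's English description precedes it below -/
import Mathlib

section
/- Let t be a nonzero complex number, u a complex number, and let A = [[t, 1], [0, t^{-1}]] and B = [[t, 0], [-u, t^{-1}]] (both of determinant 1). Let C = A·B·A^{-1}·B^{-1}, let m, n be integers, let V = C^m·A·C^{-m}·B, and let W = V^n·C^m·A·B with entries W = [[w11, w12], [w21, w22]]. Set x = t + t^{-1} and y = u + 2. Then w11 + (t^{-1} - t)·w12 = ((x^2 - y - 1)·S_m(α) - S_{m-1}(α))·S_n(β) - ((x^2 - y - 1)·S_{m-1}(α) - S_{m-2}(α))·S_{n-1}(β), where α = y^2 - x^2·y + 2x^2 - 2 and β = 2 + (x^2 - y - 2)·(S_m(α) + (1 - y)·S_{m-1}(α))^2. -/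
open Polynomial in
/-- A sequence with the initial values and the recurrence of the Chebyshev `S` polynomials
consists of their values. -/
theorem eq_eval_chebyshev_S {R : Type*} [CommRing R] {z : R} {f : ℤ → R} (h0 : f 0 = 1)
    (h1 : f 1 = z) (hrec : ∀ k, f k = z * f (k - 1) - f (k - 2)) (k : ℤ) :
    f k = (Chebyshev.S R k).eval z := by
  induction k using Chebyshev.induct with
  | zero => simpa using h0
  | one => simpa using h1
  | add_two k ih1 ih0 =>
    have h := hrec (k + 2)
    rw [show (k : ℤ) + 2 - 1 = k + 1 by ring, add_sub_cancel_right, ih1, ih0] at h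
    simpa [Chebyshev.S_add_two] using h
  | neg_add_one k ih0 ih1 =>
    have h := hrec (-k + 1)
    rw [show -(k : ℤ) + 1 - 1 = -k by ring, show -(k : ℤ) + 1 - 2 = -k - 1 by ring, ih0, ih1] at h
    simp only [Chebyshev.S_sub_one, eval_sub, eval_mul, eval_X]
    linear_combination h

open Polynomial in
theorem Matrix.SpecialLinearGroup.coe_zpow_eq_chebyshev_S {R : Type*} [CommRing R]
    (M : Matrix.SpecialLinearGroup (Fin 2) R) (k : ℤ) :
    ((M ^ k : Matrix.SpecialLinearGroup (Fin 2) R) : Matrix (Fin 2) (Fin 2) R) =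
      (Chebyshev.S R (k - 1)).eval (M : Matrix (Fin 2) (Fin 2) R).trace • (M : Matrix _ _ R) -
        (Chebyshev.S R (k - 2)).eval (M : Matrix (Fin 2) (Fin 2) R).trace • 1 := by
  have hdet := M.det_coe
  rw [Matrix.det_fin_two] at hdet
  induction k using Int.induction_on with
  | zero => simp
  | succ k ih =>
    have h := congrArg (eval (M : Matrix (Fin 2) (Fin 2) R).trace) (Chebyshev.S_eq R (k : ℤ))
    simp only [eval_sub, eval_mul, eval_X] at h
    rw [_root_.zpow_add_one, Matrix.SpecialLinearGroup.coe_mul, ih, add_sub_cancel_right,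
      show (k : ℤ) + 1 - 2 = k - 1 by ring, h]
    generalize eval _ (Chebyshev.S R ((k : ℤ) - 1)) = a
    generalize eval _ (Chebyshev.S R ((k : ℤ) - 2)) = b
    ext i j
    fin_cases i <;> fin_cases j <;>
      simp [Matrix.mul_apply, Matrix.trace_fin_two, Fin.sum_univ_two]
    · linear_combination -a * hdet
    · ring
    · ring
    · linear_combination -a * hdet
  | pred k ih =>
    have h := congrArg (eval (M : Matrix (Fin 2) (Fin 2) R).trace)
      (Chebyshev.S_eq R (-(k : ℤ) - 1))
    simp only [eval_sub, eval_mul, eval_X] at h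
    rw [show -(k : ℤ) - 1 - 1 = -k - 2 by ring] at h
    rw [_root_.zpow_sub_one, Matrix.SpecialLinearGroup.coe_mul, ih, h,
      show -(k : ℤ) - 1 - 1 = -k - 2 by ring, Matrix.SpecialLinearGroup.coe_inv]
    generalize eval _ (Chebyshev.S R (-(k : ℤ) - 2)) = a
    generalize eval _ (Chebyshev.S R (-(k : ℤ) - 1 - 2)) = b
    ext i j
    fin_cases i <;> fin_cases j <;>
      simp [Matrix.mul_apply, Matrix.trace_fin_two, Fin.sum_univ_two, Matrix.adjugate_fin_two]
    · linear_combination (a * M 0 0 + a * M 1 1 - b) * hdet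
    · ring
    · ring
    · linear_combination (a * M 0 0 + a * M 1 1 - b) * hdet


/-- With `A = [[t, 1], [0, t⁻¹]]`, `B = [[t, 0], [-u, t⁻¹]]` (`t ≠ 0`),
`C = A B A⁻¹ B⁻¹`, `V = Cᵐ A C⁻ᵐ B`, `W = Vⁿ Cᵐ A B = [[w11, w12], [w21, w22]]`,
`x = t + t⁻¹`, `y = u + 2`, `α = y² - x² y + 2x² - 2` and
`β = 2 + (x² - y - 2)(S_m(α) + (1 - y) S_{m-1}(α))²`, one has
`w11 + (t⁻¹ - t) w12 = ((x² - y - 1) S_m(α) - S_{m-1}(α)) S_n(β)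
  - ((x² - y - 1) S_{m-1}(α) - S_{m-2}(α)) S_{n-1}(β)`. -/
theorem riley_polynomial_formula
    (S : ℤ → ℂ → ℂ)
    (hS0 : ∀ z : ℂ, S 0 z = 1)
    (hS1 : ∀ z : ℂ, S 1 z = z)
    (hSrec : ∀ (k : ℤ) (z : ℂ), S k z = z * S (k - 1) z - S (k - 2) z)
    (t u : ℂ) (ht : t ≠ 0)
    (A B : Matrix.SpecialLinearGroup (Fin 2) ℂ)
    (hA : (A : Matrix (Fin 2) (Fin 2) ℂ) = !![t, 1; 0, t⁻¹])
    (hB : (B : Matrix (Fin 2) (Fin 2) ℂ) = !![t, 0; -u, t⁻¹])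
    (m n : ℤ) (C V W : Matrix.SpecialLinearGroup (Fin 2) ℂ)
    (hC : C = A * B * A⁻¹ * B⁻¹)
    (hV : V = C ^ m * A * C ^ (-m) * B)
    (hW : W = V ^ n * C ^ m * A * B)
    (w11 w12 : ℂ)
    (hw11 : w11 = (W : Matrix (Fin 2) (Fin 2) ℂ) 0 0)
    (hw12 : w12 = (W : Matrix (Fin 2) (Fin 2) ℂ) 0 1)
    (x y α β : ℂ) (hx : x = t + t⁻¹) (hy : y = u + 2)
    (hα : α = y ^ 2 - x ^ 2 * y + 2 * x ^ 2 - 2)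
    (hβ : β = 2 + (x ^ 2 - y - 2) * (S m α + (1 - y) * S (m - 1) α) ^ 2) :
    w11 + (t⁻¹ - t) * w12 =
      ((x ^ 2 - y - 1) * S m α - S (m - 1) α) * S n β -
        ((x ^ 2 - y - 1) * S (m - 1) α - S (m - 2) α) * S (n - 1) β := by
  obtain rfl : S = fun k z => (Polynomial.Chebyshev.S ℂ k).eval z := by
    funext k z
    exact eq_eval_chebyshev_S (hS0 z) (hS1 z) (fun k => hSrec k z) k
  beta_reduce at hSrec hβ ⊢
  have hCmat : (C : Matrix (Fin 2) (Fin 2) ℂ) =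
      !![t, 1; 0, t⁻¹] * !![t, 0; -u, t⁻¹] * !![t⁻¹, -1; 0, t] * !![t⁻¹, 0; u, t] := by
    simp [hC, hA, hB, Matrix.SpecialLinearGroup.coe_inv, Matrix.adjugate_fin_two]
  have htrC : (C : Matrix (Fin 2) (Fin 2) ℂ).trace = α := by
    rw [hCmat, hα, hx, hy]
    simp [Matrix.trace_fin_two]
    field_simp
    ring
  have hCm := C.coe_zpow_eq_chebyshev_S m
  have hVn := V.coe_zpow_eq_chebyshev_S n
  have hm := hSrec m α
  have hn := hSrec n β
  have hsq := congrArg (Polynomial.eval α) (Polynomial.Chebyshev.S_sq_add_S_sq ℂ (m - 1))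
  simp only [sub_add_cancel, Polynomial.eval_sub, Polynomial.eval_add, Polynomial.eval_mul,
    Polynomial.eval_pow, Polynomial.eval_X, Polynomial.eval_one] at hsq
  rw [htrC] at hCm
  rw [hn]
  generalize (Polynomial.Chebyshev.S ℂ m).eval α = a at *
  generalize (Polynomial.Chebyshev.S ℂ (m - 1)).eval α = b at *
  have hc : (Polynomial.Chebyshev.S ℂ (m - 2)).eval α = α * b - a := by
    linear_combination hm
  rw [hc] at hCm ⊢
  have hVmat : (V : Matrix (Fin 2) (Fin 2) ℂ) = (b • C.1 - (α * b - a) • 1) * !![t, 1; 0, t⁻¹] *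
      (b • C.1 - (α * b - a) • 1).adjugate * !![t, 0; -u, t⁻¹] := by
    simp only [hV, zpow_neg, Matrix.SpecialLinearGroup.coe_mul, Matrix.SpecialLinearGroup.coe_inv,
      hCm, hA, hB]
  have hpoly : Matrix.trace V.1 - β = 2 * (b ^ 2 + a ^ 2 - α * b * a - 1) := by
    rw [hVmat, hβ, hCmat, Matrix.adjugate_fin_two, Matrix.trace_fin_two, hα, hx, hy]
    simp [Matrix.mul_apply, Fin.sum_univ_two]
    field_simp
    ring
  have htrV : Matrix.trace V.1 = β := by
    linear_combination hpoly + 2 * hsq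
  rw [htrV] at hVn
  generalize (Polynomial.Chebyshev.S ℂ (n - 1)).eval β = p at *
  generalize (Polynomial.Chebyshev.S ℂ (n - 2)).eval β = q at *
  set N : Matrix (Fin 2) (Fin 2) ℂ :=
    (b • C.1 - (α * b - a) • 1) * !![t, 1; 0, t⁻¹] * !![t, 0; -u, t⁻¹] with hN
  have hWmat : W.1 = p • (V.1 * N) - q • N := by
    simp only [hW, Matrix.SpecialLinearGroup.coe_mul, hCm, hVn, hA, hB, hN, Matrix.mul_assoc,
      Matrix.sub_mul, Matrix.smul_mul, Matrix.one_mul]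
  have hNval : N 0 0 + (t⁻¹ - t) * N 0 1 = (x ^ 2 - y - 1) * a - b := by
    rw [hN, hCmat, hα, hx, hy]
    simp [Matrix.mul_apply, Fin.sum_univ_two]
    field_simp
    ring
  have hVN : (V.1 * N) 0 0 + (t⁻¹ - t) * (V.1 * N) 0 1 -
      (β * ((x ^ 2 - y - 1) * a - b) - ((x ^ 2 - y - 1) * b - (α * b - a))) =
      (2 * ((x ^ 2 - y - 1) * a - b) - ((x ^ 2 - y - 1) * b - (α * b - a))) *
        (b ^ 2 + a ^ 2 - α * b * a - 1) := by
    rw [hN, hVmat, hβ, hCmat, Matrix.adjugate_fin_two, hα, hx, hy]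
    simp [Matrix.mul_apply, Fin.sum_univ_two]
    field_simp
    ring
  have hW00 := congrFun (congrFun hWmat 0) 0
  have hW01 := congrFun (congrFun hWmat 0) 1
  simp only [Matrix.sub_apply, Matrix.smul_apply, smul_eq_mul] at hW00 hW01
  rw [hw11, hw12, hW00, hW01]
  linear_combination p * hVN - q * hNval +
    p * (2 * ((x ^ 2 - y - 1) * a - b) - ((x ^ 2 - y - 1) * b - (α * b - a))) * hsq
end

section
/- Let n ≥ 2 and m ≤ -1 be integers, and let x be a real number with 4 ≥ x^2 > 2 + 2cos((2n-3)π/(2n+1)). Then there exists a real number y > 2 such that R_{n,m}(x,y) = 0. -/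
open Real

/-- `α = y² - x² y + 2x² - 2`. -/
noncomputable def chebAlpha (x y : ℝ) : ℝ := y ^ 2 - x ^ 2 * y + 2 * x ^ 2 - 2

/-- `β = 2 + (x² - y - 2)(S_m(α) + (1 - y) S_{m-1}(α))²`. -/
noncomputable def chebBeta (S : ℤ → ℝ → ℝ) (m : ℤ) (x y : ℝ) : ℝ :=
  2 + (x ^ 2 - y - 2) *
    (S m (chebAlpha x y) + (1 - y) * S (m - 1) (chebAlpha x y)) ^ 2

/-- The Riley polynomial `R_{n,m}(x,y)` of the rational knot `C(2n+1, 2m, 2)`. -/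
noncomputable def RileyR (S : ℤ → ℝ → ℝ) (n m : ℤ) (x y : ℝ) : ℝ :=
  ((x ^ 2 - y - 1) * S m (chebAlpha x y) - S (m - 1) (chebAlpha x y)) *
      S n (chebBeta S m x y) -
    ((x ^ 2 - y - 1) * S (m - 1) (chebAlpha x y) - S (m - 2) (chebAlpha x y)) *
      S (n - 1) (chebBeta S m x y)

open Polynomial in
/-- The Chebyshev recurrence on `ℤ` determines the polynomial functions. -/
theorem eq_eval_chebyshev_S_s13 (S : ℤ → ℝ → ℝ)
    (hS0 : ∀ z : ℝ, S 0 z = 1)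
    (hS1 : ∀ z : ℝ, S 1 z = z)
    (hSrec : ∀ (k : ℤ) (z : ℝ), S k z = z * S (k - 1) z - S (k - 2) z) :
    S = fun k z => (Chebyshev.S ℝ k).eval z := by
  funext k z
  induction k using Chebyshev.induct with
  | zero => simp [hS0]
  | one => simp [hS1]
  | add_two n h1 h0 =>
    have h := hSrec (n + 2) z
    rw [show (n : ℤ) + 2 - 1 = n + 1 by ring, add_sub_cancel_right, h1, h0] at h
    simp [h, Chebyshev.S_add_two]
  | neg_add_one n h0 h1 =>
    have h := hSrec (-n + 1) z
    rw [add_sub_cancel_right, show -(n : ℤ) + 1 - 2 = -n - 1 by ring, h0, h1] at h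
    rw [Chebyshev.S_sub_one]
    simp only [eval_sub, eval_mul, eval_X]
    linarith

open Polynomial in
/-- On `[2, ∞)` the values `S_{k-1}`, for natural `k`, are nonnegative and increase with `k` by at
least one at each step. -/
theorem chebyshev_S_eval_growth {z : ℝ} (hz : 2 ≤ z) (k : ℕ) :
    0 ≤ (Chebyshev.S ℝ (k - 1)).eval z ∧
      (Chebyshev.S ℝ (k - 1)).eval z + 1 ≤ (Chebyshev.S ℝ k).eval z := by
  induction k with
  | zero => simp
  | succ k ih =>
    obtain ⟨h0, h1⟩ := ih
    push_cast
    rw [add_sub_cancel_right, Chebyshev.S_add_one]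
    simp only [eval_sub, eval_mul, eval_X]
    exact ⟨by linarith, by nlinarith⟩

open Polynomial in
/-- The roots of `S_n - S_{n-1}` are the numbers `2 cos θ` with `(2n+1)θ = (2j-1)π`. -/
theorem chebyshev_S_eval_two_mul_cos {n j : ℤ} {θ : ℝ} (hθ : (2 * n + 1) * θ = (2 * j - 1) * π)
    (hs : sin θ ≠ 0) :
    (Chebyshev.S ℝ n).eval (2 * cos θ) = (Chebyshev.S ℝ (n - 1)).eval (2 * cos θ) ∧
      (Chebyshev.S ℝ n).eval (2 * cos θ) * sin θ = -cos (j * π) * cos (θ / 2) := by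
  have hj : sin (j * π) = 0 := sin_int_mul_pi j
  have h1 : (Chebyshev.S ℝ n).eval (2 * cos θ) * sin θ = -cos (j * π) * cos (θ / 2) := by
    rw [Chebyshev.S_two_mul_real_cos,
      show ((n : ℝ) + 1) * θ = (j * π - π / 2) + θ / 2 by linarith, sin_add, sin_sub, cos_sub, hj]
    simp
  have h2 : (Chebyshev.S ℝ (n - 1)).eval (2 * cos θ) * sin θ = -cos (j * π) * cos (θ / 2) := by
    rw [Chebyshev.S_two_mul_real_cos,
      show (((n - 1 : ℤ) : ℝ) + 1) * θ = (j * π - π / 2) - θ / 2 by push_cast; linarith,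
      sin_sub, sin_sub, cos_sub, hj]
    simp
  exact ⟨mul_right_cancel₀ hs (h1.trans h2.symm), h1⟩

theorem two_le_chebAlpha {x y : ℝ} (hx : x ^ 2 ≤ 4) (hy : 2 ≤ y) : 2 ≤ chebAlpha x y := by
  unfold chebAlpha
  nlinarith [mul_nonneg (sub_nonneg.2 hy) (show 0 ≤ y + 2 - x ^ 2 by linarith)]

open Polynomial in
theorem chebBeta_two (m : ℤ) (x : ℝ) :
    chebBeta (fun k z => (Chebyshev.S ℝ k).eval z) m x 2 = x ^ 2 - 2 := by
  have h : chebAlpha x 2 = 2 := by unfold chebAlpha; ring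
  simp only [chebBeta, h, Chebyshev.S_eval_two]
  push_cast
  ring

open Polynomial in
theorem continuous_chebBeta (m : ℤ) (x : ℝ) :
    Continuous (chebBeta (fun k z => (Chebyshev.S ℝ k).eval z) m x) := by
  unfold chebBeta chebAlpha
  fun_prop

open Polynomial in
theorem continuous_RileyR (n m : ℤ) (x : ℝ) :
    Continuous (RileyR (fun k z => (Chebyshev.S ℝ k).eval z) n m x) := by
  have := continuous_chebBeta m x
  unfold RileyR chebAlpha
  fun_prop

open Polynomial in
theorem chebBeta_four_le {m : ℤ} (hm : m ≤ -1) {x : ℝ} (hx : x ^ 2 ≤ 4) :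
    chebBeta (fun k z => (Chebyshev.S ℝ k).eval z) m x 4 ≤ -2 := by
  obtain ⟨p, rfl⟩ : ∃ p : ℕ, m = -p - 1 := ⟨(-m - 1).toNat, by omega⟩
  obtain ⟨h0, h1⟩ := chebyshev_S_eval_growth (two_le_chebAlpha hx (by norm_num : (2 : ℝ) ≤ 4)) p
  simp only [chebBeta, show (-p - 1 - 1 : ℤ) = -p - 2 by ring, Chebyshev.S_neg_sub_two,
    Chebyshev.S_neg_sub_one, eval_neg]
  generalize eval (chebAlpha x 4) (Chebyshev.S ℝ (p - 1)) = a at *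
  generalize eval (chebAlpha x 4) (Chebyshev.S ℝ p) = b at *
  nlinarith [mul_nonneg (show 0 ≤ 4 - x ^ 2 by linarith) (sq_nonneg (-a + (1 - 4) * -b)),
    pow_le_pow_left₀ (by norm_num : (0 : ℝ) ≤ 2) (show 2 ≤ -a + (1 - 4) * -b by linarith) 2]

open Polynomial in
/-- Where `S_n(β) = S_{n-1}(β)`, the Riley polynomial is a negative multiple of `S_n(β)`. -/
theorem exists_neg_RileyR_eq_mul {n m : ℤ} (hm : m ≤ -1) {x y : ℝ} (hx : x ^ 2 ≤ 4) (hy : 2 < y)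
    {b : ℝ} (hb : chebBeta (fun k z => (Chebyshev.S ℝ k).eval z) m x y = b)
    (h : (Chebyshev.S ℝ n).eval b = (Chebyshev.S ℝ (n - 1)).eval b) :
    ∃ c < 0, RileyR (fun k z => (Chebyshev.S ℝ k).eval z) n m x y =
      c * (Chebyshev.S ℝ n).eval b := by
  obtain ⟨p, rfl⟩ : ∃ p : ℕ, m = -p - 1 := ⟨(-m - 1).toNat, by omega⟩
  have hα := two_le_chebAlpha hx hy.le
  obtain ⟨h0, h1⟩ := chebyshev_S_eval_growth hα p
  have h2 := congrArg (eval (chebAlpha x y)) (Chebyshev.S_add_one ℝ (p : ℤ))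
  simp only [eval_sub, eval_mul, eval_X] at h2
  simp only [RileyR, hb, ← h, show (-p - 1 - 1 : ℤ) = -p - 2 by ring,
    show (-p - 1 - 2 : ℤ) = -(p + 1) - 2 by ring, Chebyshev.S_neg_sub_two,
    Chebyshev.S_neg_sub_one, eval_neg, h2, ← sub_mul]
  refine ⟨_, ?_, rfl⟩
  generalize eval (chebAlpha x y) (Chebyshev.S ℝ (p - 1)) = u at *
  generalize eval (chebAlpha x y) (Chebyshev.S ℝ p) = v at *
  nlinarith [mul_nonneg (sub_nonneg.2 hα) (show 0 ≤ v by linarith),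
    mul_pos (show 0 < y + 2 - x ^ 2 by linarith) (show 0 < v - u by linarith)]

/-- `chebBeta` takes on `(2, 4]` every value `2 cos θ` below `x² - 2`. -/
theorem exists_chebBeta_eq_two_mul_cos {m : ℤ} (hm : m ≤ -1) {x : ℝ} (hx : x ^ 2 ≤ 4) {θ : ℝ}
    (h : 2 + 2 * cos θ < x ^ 2) :
    ∃ y, 2 < y ∧
      chebBeta (fun k z => (Polynomial.Chebyshev.S ℝ k).eval z) m x y = 2 * cos θ := by
  obtain ⟨y, hy, e⟩ := intermediate_value_Icc' (by norm_num : (2 : ℝ) ≤ 4)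
    (continuous_chebBeta m x).continuousOn
    (show 2 * cos θ ∈ Set.Icc _ _ from
      ⟨by linarith [chebBeta_four_le hm hx, neg_one_le_cos θ], by rw [chebBeta_two]; linarith⟩)
  refine ⟨y, lt_of_le_of_ne hy.1 ?_, e⟩
  rintro rfl
  rw [chebBeta_two] at e
  linarith

/-- For `n ≥ 2`, `m ≤ -1` and real `x` with `4 ≥ x² > 2 + 2 cos((2n-3)π/(2n+1))`,
the equation `R_{n,m}(x,y) = 0` has a real solution `y > 2`. -/
theorem riley_root_case2
    (S : ℤ → ℝ → ℝ)
    (hS0 : ∀ z : ℝ, S 0 z = 1)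
    (hS1 : ∀ z : ℝ, S 1 z = z)
    (hSrec : ∀ (k : ℤ) (z : ℝ), S k z = z * S (k - 1) z - S (k - 2) z)
    (n m : ℤ) (hn : 2 ≤ n) (hm : m ≤ -1) (x : ℝ)
    (hx4 : x ^ 2 ≤ 4)
    (hx : 2 + 2 * Real.cos ((2 * n - 3) * π / (2 * n + 1)) < x ^ 2) :
    ∃ y : ℝ, 2 < y ∧ RileyR S n m x y = 0 := by
  obtain rfl := eq_eval_chebyshev_S_s13 S hS0 hS1 hSrec
  have hn' : (2 : ℝ) ≤ n := by exact_mod_cast hn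
  have hd : (0 : ℝ) < 2 * n + 1 := by linarith
  set θ₁ : ℝ := (2 * n - 3) * π / (2 * n + 1) with hθ₁
  set θ₂ : ℝ := (2 * n - 1) * π / (2 * n + 1) with hθ₂
  have pos₁ : 0 < θ₁ := div_pos (mul_pos (by linarith) pi_pos) hd
  have lt₁₂ : θ₁ < θ₂ := div_lt_div_of_pos_right (by nlinarith [pi_pos]) hd
  have lt₂ : θ₂ < π := by rw [hθ₂, div_lt_iff₀ hd]; nlinarith [pi_pos]
  have sin₁ : 0 < sin θ₁ := sin_pos_of_pos_of_lt_pi pos₁ (lt₁₂.trans lt₂)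
  have sin₂ : 0 < sin θ₂ := sin_pos_of_pos_of_lt_pi (pos₁.trans lt₁₂) lt₂
  have cos₁ : 0 ≤ cos (θ₁ / 2) := cos_nonneg_of_mem_Icc ⟨by linarith, by linarith⟩
  have cos₂ : 0 ≤ cos (θ₂ / 2) := cos_nonneg_of_mem_Icc ⟨by linarith, by linarith⟩
  have cos_lt : cos θ₂ < cos θ₁ := cos_lt_cos_of_nonneg_of_le_pi pos₁.le lt₂.le lt₁₂
  obtain ⟨y₁, hy₁, e₁⟩ := exists_chebBeta_eq_two_mul_cos hm hx4 hx
  obtain ⟨y₂, hy₂, e₂⟩ := exists_chebBeta_eq_two_mul_cos hm hx4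
    (show 2 + 2 * cos θ₂ < x ^ 2 by linarith)
  obtain ⟨s₁, t₁⟩ := chebyshev_S_eval_two_mul_cos (n := n) (j := n - 1) (θ := θ₁)
    (by rw [hθ₁]; field_simp; push_cast; ring) sin₁.ne'
  obtain ⟨s₂, t₂⟩ := chebyshev_S_eval_two_mul_cos (n := n) (j := n) (θ := θ₂)
    (by rw [hθ₂]; field_simp) sin₂.ne'
  obtain ⟨c₁, hc₁, r₁⟩ := exists_neg_RileyR_eq_mul hm hx4 hy₁ e₁ s₁
  obtain ⟨c₂, hc₂, r₂⟩ := exists_neg_RileyR_eq_mul hm hx4 hy₂ e₂ s₂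
  rw [Int.cast_sub, Int.cast_one, sub_mul, one_mul, cos_sub_pi, neg_neg] at t₁
  set R := RileyR (fun k z => (Polynomial.Chebyshev.S ℝ k).eval z) n m x
  have opposite : R y₁ * R y₂ ≤ 0 := by
    have key : R y₁ * R y₂ * (sin θ₁ * sin θ₂) =
        -((c₁ * c₂) * (cos (n * π) ^ 2 * (cos (θ₁ / 2) * cos (θ₂ / 2)))) := by
      rw [r₁, r₂]
      linear_combination c₁ * c₂ * (Polynomial.Chebyshev.S ℝ n).eval (2 * cos θ₂) * sin θ₂ * t₁ +
        c₁ * c₂ * cos (n * π) * cos (θ₁ / 2) * t₂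
    refine nonpos_of_mul_nonpos_left (key.trans_le ?_) (mul_pos sin₁ sin₂)
    have := mul_pos_of_neg_of_neg hc₁ hc₂
    exact neg_nonpos.2 (by positivity)
  have zero_mem : (0 : ℝ) ∈ Set.uIcc (R y₁) (R y₂) := by
    rw [Set.mem_uIcc]
    rcases mul_nonpos_iff.1 opposite with h | h
    · exact Or.inr h.symm
    · exact Or.inl h
  obtain ⟨y, hy, e⟩ := intermediate_value_uIcc (continuous_RileyR n m x).continuousOn zero_mem
  exact ⟨y, (lt_min hy₁ hy₂).trans_le hy.1, e⟩
end

section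
/- Let m be an integer and r a positive integer. The equation R_{1,m}(2cos(π/r), y) = 0 has at least one real solution y > 2 in the following cases: (1) r ≥ 7 when m ≤ -4; (2) r ≥ 8 when m = -2 or m = -3; (3) r ≥ 9 when m = -1. -/
open Real

open Polynomial in
/-- The Chebyshev recurrence over `ℤ` determines the sequence of functions. -/
lemma eq_eval_chebyshevS (S : ℤ → ℝ → ℝ) (hS0 : ∀ z : ℝ, S 0 z = 1) (hS1 : ∀ z : ℝ, S 1 z = z)
    (hSrec : ∀ (k : ℤ) (z : ℝ), S k z = z * S (k - 1) z - S (k - 2) z) :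
    S = fun k z ↦ (Chebyshev.S ℝ k).eval z := by
  funext k z
  induction k using Chebyshev.induct with
  | zero => simp [hS0]
  | one => simp [hS1]
  | add_two n ih1 ih2 =>
    rw [hSrec, show (n : ℤ) + 2 - 1 = n + 1 by ring, add_sub_cancel_right, ih1, ih2,
      Chebyshev.S_add_two]
    simp
  | neg_add_one n ih1 ih2 =>
    have h := hSrec (-n + 1) z
    rw [show -(n : ℤ) + 1 - 1 = -n by ring, show -(n : ℤ) + 1 - 2 = -n - 1 by ring, ih1, ih2] at h
    rw [Chebyshev.S_sub_one]
    simp only [eval_sub, eval_mul, eval_X]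
    linarith

open Polynomial in
lemma chebyshevS_eval_nonneg_and_add_one_le {z : ℝ} (hz : 2 ≤ z) (n : ℕ) :
    0 ≤ (Chebyshev.S ℝ (n - 1)).eval z ∧
      (Chebyshev.S ℝ (n - 1)).eval z + 1 ≤ (Chebyshev.S ℝ n).eval z := by
  induction n with
  | zero => simp
  | succ n ih =>
    obtain ⟨h0, h1⟩ := ih
    push_cast
    rw [add_sub_cancel_right, Chebyshev.S_add_one]
    simp only [eval_sub, eval_mul, eval_X]
    constructor <;> nlinarith

open Polynomial in
lemma continuous_rileyR_one (m : ℤ) (x : ℝ) :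
    Continuous (RileyR (fun k z ↦ (Chebyshev.S ℝ k).eval z) 1 m x) := by
  unfold RileyR chebBeta chebAlpha
  fun_prop

open Polynomial in
lemma rileyR_one_two (m : ℤ) (x : ℝ) :
    RileyR (fun k z ↦ (Chebyshev.S ℝ k).eval z) 1 m x 2 =
      1 + (4 - x ^ 2) * (-m * (x ^ 2 - 3) - (x ^ 2 - 1)) := by
  have hα : chebAlpha x 2 = 2 := by unfold chebAlpha; ring
  simp only [RileyR, chebBeta, hα, Chebyshev.S_eval_two, Chebyshev.S_one, sub_self,
    Chebyshev.S_zero, eval_X, eval_one]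
  push_cast
  ring

open Polynomial in
lemma rileyR_one_five_neg {m : ℤ} (hm : m ≤ -1) {x : ℝ} (hx : x ^ 2 ≤ 4) :
    RileyR (fun k z ↦ (Chebyshev.S ℝ k).eval z) 1 m x 5 < 0 := by
  obtain ⟨n, rfl⟩ : ∃ n : ℕ, m = -n - 1 := ⟨(-m - 1).toNat, by omega⟩
  have hα : 2 ≤ chebAlpha x 5 := by unfold chebAlpha; linarith
  obtain ⟨h0, h1⟩ := chebyshevS_eval_nonneg_and_add_one_le hα n
  have e1 : Chebyshev.S ℝ (-n - 1) = -Chebyshev.S ℝ (n - 1) := Chebyshev.S_neg_sub_one ℝ n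
  have e2 : Chebyshev.S ℝ (-n - 1 - 1) = -Chebyshev.S ℝ n := by
    rw [sub_sub]; exact Chebyshev.S_neg_sub_two ℝ n
  have e3 : Chebyshev.S ℝ (-n - 1 - 2) = -Chebyshev.S ℝ (n + 1) := by
    rw [← Chebyshev.S_neg_sub_two, neg_add']
  simp only [RileyR, chebBeta, e1, e2, e3, Chebyshev.S_one, sub_self, Chebyshev.S_zero,
    Chebyshev.S_add_one, eval_X, eval_one, eval_neg, eval_sub, eval_mul]
  generalize chebAlpha x 5 = α at *
  generalize (Chebyshev.S ℝ (n - 1)).eval α = a at *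
  generalize (Chebyshev.S ℝ n).eval α = b at *
  have hβ : 2 + (x ^ 2 - 5 - 2) * (-a + (1 - 5) * -b) ^ 2 ≤ 0 := by
    nlinarith [mul_self_nonneg (-a + (1 - 5) * -b - 1)]
  generalize 2 + (x ^ 2 - 5 - 2) * (-a + (1 - 5) * -b) ^ 2 = β at *
  have hw : 0 ≤ 6 - x ^ 2 := by linarith
  have hA : 0 ≤ (6 - x ^ 2) * a + b := add_nonneg (mul_nonneg hw h0) (by linarith)
  have hB : 0 ≤ (6 - x ^ 2) * b := mul_nonneg hw (by linarith)
  nlinarith [mul_nonneg hA (neg_nonneg.2 hβ), mul_nonneg (sub_nonneg.2 hα) (by linarith : 0 ≤ b)]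

lemma exists_rileyR_one_root {m : ℤ} (hm : m ≤ -1) {x : ℝ} (hx : x ^ 2 ≤ 4)
    (hpos : 0 < 1 + (4 - x ^ 2) * (-m * (x ^ 2 - 3) - (x ^ 2 - 1))) :
    ∃ y : ℝ, 2 < y ∧
      RileyR (fun k z ↦ (Polynomial.Chebyshev.S ℝ k).eval z) 1 m x y = 0 := by
  rw [← rileyR_one_two] at hpos
  obtain ⟨y, hy, h⟩ := intermediate_value_Ioo' (by norm_num : (2 : ℝ) ≤ 5)
    (continuous_rileyR_one m x).continuousOn ⟨rileyR_one_five_neg hm hx, hpos⟩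
  exact ⟨y, hy.1, h⟩

/-- This bounds `4 - (2 cos (π / r))² = 16 s (1 - s)`, where `s = sin² (π / (2 r)) ≤ (π / (2 q))²`. -/
lemma four_sub_two_mul_cos_sq_le {q : ℝ} (hq : 3 ≤ q) {r : ℕ} (hr : q ≤ r) :
    4 - (2 * cos (π / r)) ^ 2 ≤ 16 * (1.5708 / q) ^ 2 * (1 - (1.5708 / q) ^ 2) := by
  have hr0 : (0 : ℝ) < r := by linarith
  have hπ : π / r / 2 ≤ 1.5708 / q := by
    rw [div_div, mul_comm, ← div_div]
    have := pi_lt_d4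
    gcongr
    linarith
  have hs : sin (π / r / 2) ^ 2 ≤ (1.5708 / q) ^ 2 :=
    sin_sq_le_sq.trans (by gcongr)
  have hq' : (1.5708 / q) ^ 2 ≤ 1 / 2 := by
    have : 1.5708 / q ≤ 1.5708 / 3 := by gcongr
    have : 0 ≤ 1.5708 / q := by positivity
    nlinarith
  have hcos : cos (π / r) = 1 - 2 * sin (π / r / 2) ^ 2 := by
    rw [← cos_two_mul_eq_one_sub]; ring_nf
  rw [hcos]
  nlinarith [mul_nonneg (sub_nonneg.2 hs) (by linarith :
    0 ≤ 1 - (1.5708 / q) ^ 2 - sin (π / r / 2) ^ 2)]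

/-- The equation `R_{1,m}(2 cos(π/r), y) = 0` has a real solution `y > 2` when
(1) `r ≥ 7` and `m ≤ -4`; (2) `r ≥ 8` and `m = -2` or `m = -3`;
(3) `r ≥ 9` and `m = -1`. -/
theorem riley_root_n_one_neg_m
    (S : ℤ → ℝ → ℝ)
    (hS0 : ∀ z : ℝ, S 0 z = 1)
    (hS1 : ∀ z : ℝ, S 1 z = z)
    (hSrec : ∀ (k : ℤ) (z : ℝ), S k z = z * S (k - 1) z - S (k - 2) z)
    (m : ℤ) (r : ℕ) (hr : 1 ≤ r) :
    (7 ≤ r → m ≤ -4 →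
      ∃ y : ℝ, 2 < y ∧ RileyR S 1 m (2 * Real.cos (π / r)) y = 0) ∧
    (8 ≤ r → (m = -2 ∨ m = -3) →
      ∃ y : ℝ, 2 < y ∧ RileyR S 1 m (2 * Real.cos (π / r)) y = 0) ∧
    (9 ≤ r → m = -1 →
      ∃ y : ℝ, 2 < y ∧ RileyR S 1 m (2 * Real.cos (π / r)) y = 0) := by
  obtain rfl := eq_eval_chebyshevS S hS0 hS1 hSrec
  have hx : (2 * cos (π / r)) ^ 2 ≤ 4 := by nlinarith [cos_sq_le_one (π / r)]
  have bound (q : ℕ) (hq : 3 ≤ q) (hqr : q ≤ r) :=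
    four_sub_two_mul_cos_sq_le (q := q) (mod_cast hq) (Nat.cast_le.2 hqr)
  refine ⟨fun h hm ↦ ?_, fun h hm ↦ ?_, fun h hm ↦ ?_⟩
  · have ht := bound 7 (by norm_num) h
    refine exists_rileyR_one_root (by omega) hx ?_
    have hm' : (m : ℝ) ≤ -4 := mod_cast hm
    generalize (2 * cos (π / r)) ^ 2 = c at *
    norm_num at ht
    have hc : 3.2346 ≤ c := by linarith
    have : 0 ≤ (4 - c) * ((-4 - m) * (c - 3)) :=
      mul_nonneg (by linarith) (mul_nonneg (by linarith) (by linarith))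
    nlinarith
  · have ht := bound 8 (by norm_num) h
    refine exists_rileyR_one_root (by omega) hx ?_
    generalize (2 * cos (π / r)) ^ 2 = c at *
    norm_num at ht
    have hc : 3.4 ≤ c := by linarith
    obtain rfl | rfl := hm <;> push_cast <;> nlinarith
  · have ht := bound 9 (by norm_num) h
    refine exists_rileyR_one_root (by omega) hx ?_
    generalize (2 * cos (π / r)) ^ 2 = c at *
    norm_num at ht
    have hc : 3.52 ≤ c := by linarith
    subst hm
    push_cast
    nlinarith
end
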